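/- Let w₁,…,w_N ∈ ℝⁿ and α ≥ √2 · max_i ‖w_i‖₂. Then |absconv{w₁,…,w_N}|^{1/n} ≤ (√(2π) e α / n) · exp( (2/n) ∑_{i=1}^N exp(-α²/(2‖w_i‖₂²)) ). -/

import Mathlib

open MeasureTheory Real Pointwise
open scoped ENNReal

theorem bm1 {A B D : Set ℝ} (hA : MeasurableSet A) (hB : MeasurableSet B) (hAn : A.Nonempty)
    (hBn : B.Nonempty) (h : ∀ a ∈ A, ∀ b ∈ B, a + b ∈ D) :
    volume A + volume B ≤ volume D := by
  have key : ∀ K L : Set ℝ, IsCompact K → IsCompact L → K ⊆ A → L ⊆ B →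
      volume K + volume L ≤ volume D := by
    have key2 : ∀ K L : Set ℝ, IsCompact K → IsCompact L → K ⊆ A → L ⊆ B → K.Nonempty →
        L.Nonempty → volume K + volume L ≤ volume D := by
      intro K L hK hL hKA hLB hKn hLn
      obtain ⟨m, hm, hmax⟩ := hK.exists_isGreatest hKn
      obtain ⟨l, hl, hmin⟩ := hL.exists_isLeast hLn
      have e1 : volume K = volume ((fun x => x + (-l)) ⁻¹' K) :=
        (measure_preimage_add_right volume (-l) K).symm
      have e2 : volume L = volume ((fun x => x + (-m)) ⁻¹' L) :=
        (measure_preimage_add_right volume (-m) L).symm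
      rw [e1, e2]
      have hm1 : MeasurableSet ((fun x : ℝ => x + (-m)) ⁻¹' L) :=
        hL.measurableSet.preimage (by fun_prop)
      rw [← measure_union_add_inter _ hm1]
      have hz : volume ((fun x : ℝ => x + (-l)) ⁻¹' K ∩ (fun x : ℝ => x + (-m)) ⁻¹' L) = 0 := by
        refine measure_mono_null (t := {m + l}) ?_ (by simp)
        rintro x ⟨h1, h2⟩
        have h3 := hmax h1
        have h4 := hmin h2
        simp only [Set.mem_singleton_iff]
        linarith
      rw [hz, add_zero]
      apply measure_mono
      rintro x (h1 | h1)
      · have := h _ (hKA h1) _ (hLB hl)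
        simpa using this
      · have := h _ (hKA hm) _ (hLB h1)
        simpa using this
    intro K L hK hL hKA hLB
    obtain ⟨a, ha⟩ := hAn
    obtain ⟨b, hb⟩ := hBn
    have := key2 (insert a K) (insert b L) (hK.insert a) (hL.insert b)
      (Set.insert_subset ha hKA) (Set.insert_subset hb hLB) (Set.insert_nonempty _ _)
      (Set.insert_nonempty _ _)
    exact le_trans (add_le_add (measure_mono (Set.subset_insert _ _))
      (measure_mono (Set.subset_insert _ _))) this
  rw [hA.measure_eq_iSup_isCompact, hB.measure_eq_iSup_isCompact]
  simp only [iSup_and']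
  exact ENNReal.biSup_add_biSup_le' ⟨∅, by simp⟩ ⟨∅, by simp⟩
    fun K hK L hL => key K L hK.2 hL.2 hK.1 hL.1

theorem layer {f : ℝ → ℝ≥0∞} (hf : Measurable f) (h1 : ∀ x, f x ≤ 1) :
    ∫⁻ x, f x = ∫⁻ t in Set.Ioo (0:ℝ) 1, volume {x | ENNReal.ofReal t < f x} := by
  have e : ∀ x, f x = ENNReal.ofReal (f x).toReal := fun x =>
    (ENNReal.ofReal_toReal (ne_top_of_le_ne_top ENNReal.one_ne_top (h1 x))).symm
  have hl := lintegral_eq_lintegral_meas_lt volume (f := fun x => (f x).toReal)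
    (Filter.Eventually.of_forall fun x => ENNReal.toReal_nonneg) hf.ennreal_toReal.aemeasurable
  simp only [← e] at hl
  rw [hl]
  rw [← lintegral_indicator measurableSet_Ioi, ← lintegral_indicator measurableSet_Ioo]
  congr 1
  ext t
  by_cases h0 : 0 < t
  · have hs : {x | ENNReal.ofReal t < f x} = {x | t < (f x).toReal} := by
      ext x
      exact ENNReal.ofReal_lt_iff_lt_toReal h0.le (ne_top_of_le_ne_top ENNReal.one_ne_top (h1 x))
    by_cases h2 : t < 1
    · simp [Set.indicator, h0, h2, hs]
    · have : {x | t < (f x).toReal} = ∅ := by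
        ext x
        have := ENNReal.toReal_mono ENNReal.one_ne_top (h1 x)
        simp at this ⊢
        linarith
      simp [Set.indicator, h0, h2, this]
  · simp [Set.indicator, h0]

theorem pl_norm {f g h : ℝ → ℝ≥0∞} (hf : Measurable f) (hg : Measurable g) (hh : Measurable h)
    (hf1 : ∀ x, f x ≤ 1) (hg1 : ∀ x, g x ≤ 1) (hf2 : ⨆ x, f x = 1) (hg2 : ⨆ x, g x = 1)
    {a b : ℝ} (ha : 0 < a) (hb : 0 < b) (hab : a + b = 1)
    (H : ∀ x y, f x ^ a * g y ^ b ≤ h (a * x + b * y)) :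
    (∫⁻ x, f x) ^ a * (∫⁻ x, g x) ^ b ≤ ∫⁻ x, h x := by
  have hmin : Measurable (fun x => min (h x) 1) := hh.min measurable_const
  have hL := layer hmin (fun x => min_le_right _ _)
  calc _ ≤ ENNReal.ofReal a * (∫⁻ x, f x) + ENNReal.ofReal b * (∫⁻ x, g x) := by
        have hpq : (a⁻¹).HolderConjugate b⁻¹ :=
          Real.holderConjugate_iff.2 ⟨(one_lt_inv₀ ha).2 (by linarith), by simpa using hab⟩
        have := ENNReal.young_inequality ((∫⁻ x, f x) ^ a) ((∫⁻ x, g x) ^ b) hpq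
        rw [← ENNReal.rpow_mul, ← ENNReal.rpow_mul, mul_inv_cancel₀ ha.ne',
          mul_inv_cancel₀ hb.ne', ENNReal.rpow_one, ENNReal.rpow_one, div_eq_mul_inv,
          div_eq_mul_inv, ENNReal.ofReal_inv_of_pos ha, ENNReal.ofReal_inv_of_pos hb, inv_inv,
          inv_inv] at this
        rwa [mul_comm (ENNReal.ofReal a), mul_comm (ENNReal.ofReal b)]
    _ = ∫⁻ t in Set.Ioo (0:ℝ) 1, (ENNReal.ofReal a * volume {x | ENNReal.ofReal t < f x} +
          ENNReal.ofReal b * volume {x | ENNReal.ofReal t < g x}) := by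
        rw [layer hf hf1, layer hg hg1]
        have mm : ∀ f : ℝ → ℝ≥0∞, Measurable (fun t : ℝ => volume {x | ENNReal.ofReal t < f x}) := by
          intro f
          refine Antitone.measurable ?_
          intro s t hst
          refine measure_mono ?_
          intro x hx
          exact lt_of_le_of_lt (ENNReal.ofReal_le_ofReal hst) hx
        rw [lintegral_add_left ((mm f).const_mul _), lintegral_const_mul _ (mm f),
          lintegral_const_mul _ (mm g)]
    _ ≤ ∫⁻ t in Set.Ioo (0:ℝ) 1, volume {x | ENNReal.ofReal t < min (h x) 1} := by
        refine setLIntegral_mono' measurableSet_Ioo ?_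
        intro t ht
        have sc : ∀ (c : ℝ) (hc : 0 < c) (S : Set ℝ), ENNReal.ofReal c * volume S =
            volume ((fun x => c⁻¹ * x) ⁻¹' S) := by
          intro c hc S
          rw [Real.volume_preimage_mul_left (inv_ne_zero hc.ne')]
          simp [abs_of_pos hc]
        rw [sc a ha, sc b hb]
        have ht1 : ENNReal.ofReal t < 1 := by
          simpa using ht.2
        apply bm1
        · exact (measurableSet_lt measurable_const hf).preimage (by fun_prop)
        · exact (measurableSet_lt measurable_const hg).preimage (by fun_prop)
        · obtain ⟨x, hx⟩ := lt_iSup_iff.1 (hf2 ▸ ht1)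
          exact ⟨a * x, by simpa [ha.ne'] using hx⟩
        · obtain ⟨x, hx⟩ := lt_iSup_iff.1 (hg2 ▸ ht1)
          exact ⟨b * x, by simpa [hb.ne'] using hx⟩
        · intro x hx y hy
          simp only [Set.mem_preimage, Set.mem_ofPred_eq] at hx hy ⊢
          refine lt_min ?_ ht1
          have h1 := H (a⁻¹ * x) (b⁻¹ * y)
          rw [mul_inv_cancel_left₀ ha.ne', mul_inv_cancel_left₀ hb.ne'] at h1
          refine lt_of_lt_of_le ?_ h1
          have : ENNReal.ofReal t = ENNReal.ofReal t ^ a * ENNReal.ofReal t ^ b := by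
            rw [← ENNReal.rpow_add_of_nonneg _ _ ha.le hb.le, hab, ENNReal.rpow_one]
          rw [this]
          exact ENNReal.mul_lt_mul (ENNReal.rpow_lt_rpow hx ha) (ENNReal.rpow_lt_rpow hy hb)
    _ = ∫⁻ x, min (h x) 1 := hL.symm
    _ ≤ _ := lintegral_mono fun x => min_le_left _ _

theorem pl_bdd {f g h : ℝ → ℝ≥0∞} (hf : Measurable f) (hg : Measurable g) (hh : Measurable h)
    {M : ℝ≥0∞} (hM : M ≠ ⊤)
    (hf1 : ∀ x, f x ≤ M) (hg1 : ∀ x, g x ≤ M)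
    {a b : ℝ} (ha : 0 < a) (hb : 0 < b) (hab : a + b = 1)
    (H : ∀ x y, f x ^ a * g y ^ b ≤ h (a * x + b * y)) :
    (∫⁻ x, f x) ^ a * (∫⁻ x, g x) ^ b ≤ ∫⁻ x, h x := by
  by_cases hF0 : ⨆ x, f x = 0
  · have : ∀ x, f x = 0 := by simpa using hF0
    simp [this, ENNReal.zero_rpow_of_pos ha]
  by_cases hG0 : ⨆ x, g x = 0
  · have : ∀ x, g x = 0 := by simpa using hG0
    simp [this, ENNReal.zero_rpow_of_pos hb]
  set F := ⨆ x, f x with hF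
  set G := ⨆ x, g x with hG
  have hFt : F ≠ ⊤ := ne_top_of_le_ne_top hM (iSup_le hf1)
  have hGt : G ≠ ⊤ := ne_top_of_le_ne_top hM (iSup_le hg1)
  have hFa0 : F ^ a ≠ 0 := by simp [ENNReal.rpow_eq_zero_iff, hF0, hFt]
  have hFat : F ^ a ≠ ⊤ := ENNReal.rpow_ne_top_of_nonneg ha.le hFt
  have hGb0 : G ^ b ≠ 0 := by simp [ENNReal.rpow_eq_zero_iff, hG0, hGt]
  have hGbt : G ^ b ≠ ⊤ := ENNReal.rpow_ne_top_of_nonneg hb.le hGt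
  have := pl_norm (f := fun x => F⁻¹ * f x) (g := fun x => G⁻¹ * g x)
    (h := fun x => (F ^ a * G ^ b)⁻¹ * h x) (hf.const_mul _) (hg.const_mul _) (hh.const_mul _)
    (fun x => by
      rw [← ENNReal.inv_mul_cancel hF0 hFt]; gcongr; exact le_iSup f x)
    (fun x => by
      rw [← ENNReal.inv_mul_cancel hG0 hGt]; gcongr; exact le_iSup g x)
    (by rw [← ENNReal.mul_iSup, ← hF, ENNReal.inv_mul_cancel hF0 hFt])
    (by rw [← ENNReal.mul_iSup, ← hG, ENNReal.inv_mul_cancel hG0 hGt]) ha hb hab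
    (fun x y => by
      rw [ENNReal.mul_rpow_of_nonneg _ _ ha.le, ENNReal.mul_rpow_of_nonneg _ _ hb.le,
        ENNReal.inv_rpow, ENNReal.inv_rpow, mul_mul_mul_comm,
        ← ENNReal.mul_inv (Or.inl hFa0) (Or.inl hFat)]
      gcongr
      exact H x y)
  rw [lintegral_const_mul _ hf, lintegral_const_mul _ hg, lintegral_const_mul _ hh,
    ENNReal.mul_rpow_of_nonneg _ _ ha.le, ENNReal.mul_rpow_of_nonneg _ _ hb.le,
    ENNReal.inv_rpow, ENNReal.inv_rpow, mul_mul_mul_comm,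
    ← ENNReal.mul_inv (Or.inl hFa0) (Or.inl hFat)] at this
  have h0 : F ^ a * G ^ b ≠ 0 := mul_ne_zero hFa0 hGb0
  have ht : F ^ a * G ^ b ≠ ⊤ := ENNReal.mul_ne_top hFat hGbt
  rwa [ENNReal.mul_le_mul_iff_right (ENNReal.inv_ne_zero.2 ht) (ENNReal.inv_ne_top.2 h0)] at this

theorem lint_trunc {f : ℝ → ℝ≥0∞} (hf : Measurable f) :
    Filter.Tendsto (fun n : ℕ => ∫⁻ x, min (f x) n) Filter.atTop (nhds (∫⁻ x, f x)) := by
  refine lintegral_tendsto_of_tendsto_of_monotone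
    (fun n => (hf.min measurable_const).aemeasurable) ?_ ?_
  · refine Filter.Eventually.of_forall fun x => ?_
    intro m n hmn
    exact min_le_min le_rfl (by exact_mod_cast hmn)
  · refine Filter.Eventually.of_forall fun x => ?_
    have := (tendsto_const_nhds (x := f x) (f := Filter.atTop)).min ENNReal.tendsto_nat_nhds_top
    simpa using this

/-- One-dimensional Prékopa–Leindler inequality. -/
theorem pl {f g h : ℝ → ℝ≥0∞} (hf : Measurable f) (hg : Measurable g) (hh : Measurable h)
    {a b : ℝ} (ha : 0 < a) (hb : 0 < b) (hab : a + b = 1)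
    (H : ∀ x y, f x ^ a * g y ^ b ≤ h (a * x + b * y)) :
    (∫⁻ x, f x) ^ a * (∫⁻ x, g x) ^ b ≤ ∫⁻ x, h x := by
  by_cases hF0 : ∫⁻ x, f x = 0
  · simp [hF0, ENNReal.zero_rpow_of_pos ha]
  by_cases hG0 : ∫⁻ x, g x = 0
  · simp [hG0, ENNReal.zero_rpow_of_pos hb]
  have t1 := ((ENNReal.continuous_rpow_const (y := a)).tendsto _).comp (lint_trunc hf)
  have t2 := ((ENNReal.continuous_rpow_const (y := b)).tendsto _).comp (lint_trunc hg)
  have t3 := ENNReal.Tendsto.mul t1 (Or.inl (by simp [ENNReal.rpow_eq_zero_iff, hF0, ha.le]))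
    t2 (Or.inl (by simp [ENNReal.rpow_eq_zero_iff, hG0, hb.le]))
  refine le_of_tendsto' t3 fun n => ?_
  refine pl_bdd (hf.min measurable_const) (hg.min measurable_const) hh
    (ENNReal.natCast_ne_top n) (fun x => min_le_right _ _) (fun x => min_le_right _ _) ha hb hab ?_
  intro x y
  refine le_trans ?_ (H x y)
  gcongr <;> exact min_le_left _ _

theorem even_lint {F : ℝ → ℝ≥0∞} (he : ∀ s, F (-s) = F s) :
    ∫⁻ s, F s = 2 * ∫⁻ s in Set.Ioi 0, F s := by
  have h1 : ∫⁻ s, F s = (∫⁻ s in Set.Iic 0, F s) + ∫⁻ s in Set.Ioi 0, F s := by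
    rw [← lintegral_add_compl F measurableSet_Iic, Set.compl_Iic]
  have h2 : ∫⁻ s in Set.Iic 0, F s = ∫⁻ s in Set.Ioi 0, F s := by
    rw [setLIntegral_congr (Iio_ae_eq_Iic (a := (0:ℝ))).symm]
    rw [← lintegral_indicator measurableSet_Iio, ← lintegral_indicator measurableSet_Ioi,
      ← lintegral_neg_eq_self]
    congr 1
    ext x
    simp [Set.indicator, he]
  rw [h1, h2, two_mul]

theorem exp_change (F : ℝ → ℝ≥0∞) :
    ∫⁻ s in Set.Ioi 0, F s = ∫⁻ u, ENNReal.ofReal (Real.exp u) * F (Real.exp u) := by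
  have := lintegral_image_eq_lintegral_abs_deriv_mul (s := Set.univ) (f := Real.exp)
    (f' := Real.exp) MeasurableSet.univ (fun x _ => (Real.hasDerivAt_exp x).hasDerivWithinAt)
    (Real.exp_injective.injOn) F
  rw [Set.image_univ, Real.range_exp] at this
  rw [this]
  simp

theorem half_gauss : ∫⁻ s in Set.Ioi (0:ℝ), ENNReal.ofReal (Real.exp (-(s^2/2))) =
    ENNReal.ofReal (√(2 * π) / 2) := by
  have h := integral_gaussian_Ioi (1/2)
  rw [← ofReal_integral_eq_lintegral_ofReal]
  · congr 1
    have e : ∀ x : ℝ, -(x^2/2) = -(1/2) * x^2 := fun x => by ring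
    simp_rw [e, h]
    congr 2
    field_simp
  · have := (integrable_exp_neg_mul_sq (b := 1/2) (by norm_num)).integrableOn (s := Set.Ioi 0)
    refine this.congr (Filter.Eventually.of_forall fun x => ?_)
    simp only
    congr 1; ring
  · exact Filter.Eventually.of_forall fun x => (Real.exp_pos _).le

theorem san1 {F G : ℝ → ℝ≥0∞} (hF : Measurable F) (hG : Measurable G)
    (hFe : ∀ s, F (-s) = F s) (hGe : ∀ s, G (-s) = G s) {C : ℝ≥0∞}
    (H : ∀ s t, F s * G t ≤ C * ENNReal.ofReal (Real.exp (-(s * t)))) :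
    (∫⁻ s, F s) * (∫⁻ s, G s) ≤ C * ENNReal.ofReal (2 * π) := by
  have hp : (0:ℝ) < 1/2 := by norm_num
  have key := pl (f := fun u => ENNReal.ofReal (Real.exp u) * F (Real.exp u))
    (g := fun u => ENNReal.ofReal (Real.exp u) * G (Real.exp u))
    (h := fun u => C ^ (1/2 : ℝ) *
      (ENNReal.ofReal (Real.exp u) * ENNReal.ofReal (Real.exp (-((Real.exp u)^2/2)))))
    (by fun_prop) (by fun_prop) (by fun_prop) hp hp (by norm_num) (by
      intro u v
      rw [← ENNReal.mul_rpow_of_nonneg _ _ hp.le]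
      have e1 : C ^ (1/2 : ℝ) * (ENNReal.ofReal (Real.exp (1/2*u+1/2*v)) *
          ENNReal.ofReal (Real.exp (-((Real.exp (1/2*u+1/2*v))^2/2)))) =
          (ENNReal.ofReal (Real.exp u) * ENNReal.ofReal (Real.exp v) *
            (C * ENNReal.ofReal (Real.exp (-(Real.exp u * Real.exp v))))) ^ (1/2:ℝ) := by
        rw [mul_left_comm, ENNReal.mul_rpow_of_nonneg _ _ hp.le,
          ENNReal.mul_rpow_of_nonneg C _ hp.le, mul_left_comm, mul_left_comm _ (C ^ (1/2:ℝ)),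
          ← ENNReal.mul_rpow_of_nonneg _ _ hp.le,
          ← ENNReal.ofReal_mul (Real.exp_pos _).le, ← ENNReal.ofReal_mul (Real.exp_pos _).le,
          ← ENNReal.ofReal_mul (by positivity),
          ENNReal.ofReal_rpow_of_nonneg (by positivity) hp.le]
        congr 2
        rw [← Real.exp_add, ← Real.exp_add, ← Real.exp_add, ← Real.exp_mul, ← Real.exp_nat_mul]
        congr 1
        rw [show ((2:ℕ):ℝ) * (1/2*u+1/2*v) = u + v by push_cast; ring]
        ring
      rw [e1, mul_mul_mul_comm]
      exact ENNReal.rpow_le_rpow (mul_le_mul_right (H _ _) _) hp.le)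
  rw [← exp_change, ← exp_change, lintegral_const_mul _ (by fun_prop),
    ← exp_change (fun s => ENNReal.ofReal (Real.exp (-(s^2/2)))), half_gauss,
    ← ENNReal.mul_rpow_of_nonneg _ _ hp.le] at key
  have k2 := ENNReal.rpow_le_rpow key (zero_le_two (α := ℝ))
  rw [← ENNReal.rpow_mul, ENNReal.mul_rpow_of_nonneg (C ^ _) _ (by norm_num), ← ENNReal.rpow_mul,
    ENNReal.ofReal_rpow_of_nonneg (by positivity) (by norm_num)] at k2
  norm_num at k2
  rw [even_lint hFe, even_lint hGe, mul_mul_mul_comm]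
  calc _ ≤ 2 * 2 * (C * ENNReal.ofReal ((√2 * √π / 2) ^ 2)) := by gcongr
    _ = C * (2 * 2 * ENNReal.ofReal ((√2 * √π / 2) ^ 2)) := by ring
    _ = _ := by
      congr 1
      have : (2:ℝ≥0∞) * 2 = ENNReal.ofReal 4 := by norm_num
      rw [this, ← ENNReal.ofReal_mul (by norm_num)]
      congr 1
      rw [div_pow, mul_pow, Real.sq_sqrt (by norm_num), Real.sq_sqrt pi_pos.le]
      ring

/-- log-concavity of a measure, tested on open sets -/
def LC {n : ℕ} (μ : Measure (Fin n → ℝ)) : Prop :=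
  ∀ a b : ℝ, 0 < a → 0 < b → a + b = 1 → ∀ A B D : Set (Fin n → ℝ), IsOpen A → IsOpen B →
    IsOpen D → (∀ x ∈ A, ∀ y ∈ B, a • x + b • y ∈ D) → μ A ^ a * μ B ^ b ≤ μ D

theorem cont_cons (n : ℕ) : Continuous (fun p : ℝ × (Fin n → ℝ) => (Fin.cons p.1 p.2 : Fin (n+1) → ℝ)) := by
  refine continuous_pi fun i => ?_
  refine Fin.cases ?_ (fun j => ?_) i
  · simpa using continuous_fst
  · simp only [Fin.cons_succ]; fun_prop

theorem pi_mp (ρ : Measure ℝ) [SigmaFinite ρ] (n : ℕ) :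
    MeasurePreserving (fun p : ℝ × (Fin n → ℝ) => (Fin.cons p.1 p.2 : Fin (n+1) → ℝ))
      (ρ.prod (Measure.pi (fun _ : Fin n => ρ))) (Measure.pi (fun _ : Fin (n+1) => ρ)) := by
  have := (measurePreserving_piFinSuccAbove (fun _ : Fin (n+1) => ρ) 0).symm
  convert this using 1
  ext p i
  simp [MeasurableEquiv.piFinSuccAbove, Fin.insertNthEquiv]

theorem pi_slice (ρ : Measure ℝ) [SigmaFinite ρ] {n : ℕ} {A : Set (Fin (n+1) → ℝ)}
    (hA : IsOpen A) : Measure.pi (fun _ : Fin (n+1) => ρ) A =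
      ∫⁻ s, Measure.pi (fun _ : Fin n => ρ) {x | (Fin.cons s x : Fin (n+1) → ℝ) ∈ A} ∂ρ := by
  rw [← (pi_mp ρ n).measure_preimage hA.measurableSet.nullMeasurableSet,
    Measure.prod_apply (hA.preimage (cont_cons n)).measurableSet]
  rfl

theorem pi_slice' (ρ : Measure ℝ) [SigmaFinite ρ] {n : ℕ} {A : Set (Fin (n+1) → ℝ)}
    (hA : IsOpen A) : Measure.pi (fun _ : Fin (n+1) => ρ) A =
      ∫⁻ x, ρ {s | (Fin.cons s x : Fin (n+1) → ℝ) ∈ A} ∂(Measure.pi (fun _ : Fin n => ρ)) := by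
  rw [← (pi_mp ρ n).measure_preimage hA.measurableSet.nullMeasurableSet,
    Measure.prod_apply_symm (hA.preimage (cont_cons n)).measurableSet]
  rfl

theorem slice_meas (ρ : Measure ℝ) [SigmaFinite ρ] {n : ℕ} {A : Set (Fin (n+1) → ℝ)}
    (hA : IsOpen A) : Measurable (fun s : ℝ =>
      Measure.pi (fun _ : Fin n => ρ) {x | (Fin.cons s x : Fin (n+1) → ℝ) ∈ A}) :=
  measurable_measure_prodMk_left (ν := Measure.pi (fun _ : Fin n => ρ))
    (hA.preimage (cont_cons n)).measurableSet

theorem slice_open {n : ℕ} {A : Set (Fin (n+1) → ℝ)} (hA : IsOpen A) (s : ℝ) :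
    IsOpen {x | (Fin.cons s x : Fin (n+1) → ℝ) ∈ A} :=
  hA.preimage ((cont_cons n).comp (Continuous.prodMk_right s))

theorem slice_open' {n : ℕ} {A : Set (Fin (n+1) → ℝ)} (hA : IsOpen A) (x : Fin n → ℝ) :
    IsOpen {s : ℝ | (Fin.cons s x : Fin (n+1) → ℝ) ∈ A} :=
  hA.preimage ((cont_cons n).comp (Continuous.prodMk_left x))

theorem lc_pi (ρ : Measure ℝ) [SigmaFinite ρ] (r : ℝ → ℝ≥0∞) (hr : Measurable r)
    (hρ : ρ = volume.withDensity r)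
    (hlc : ∀ a b : ℝ, 0 < a → 0 < b → a + b = 1 → ∀ x y, r x ^ a * r y ^ b ≤ r (a * x + b * y))
    (n : ℕ) : LC (Measure.pi (fun _ : Fin n => ρ)) := by
  induction n with
  | zero =>
    intro a b ha hb hab A B D _ _ _ h
    rcases A.eq_empty_or_nonempty with rfl | ⟨x, hx⟩
    · simp [ENNReal.zero_rpow_of_pos ha]
    rcases B.eq_empty_or_nonempty with rfl | ⟨y, hy⟩
    · simp [ENNReal.zero_rpow_of_pos hb]
    have hD := h x hx y hy
    have : D = Set.univ := by
      exact Set.eq_univ_of_forall fun z => by rwa [Subsingleton.elim z (a • x + b • y)]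
    rw [this]
    have e : ∀ S : Set (Fin 0 → ℝ), Measure.pi (fun _ : Fin 0 => ρ) S ≤ 1 := by
      intro S
      refine (measure_mono (Set.subset_univ _)).trans ?_
      rw [Measure.pi_of_empty]; simp
    calc _ ≤ (1:ℝ≥0∞)^a * 1^b := by gcongr <;> exact e _
      _ ≤ _ := by rw [Measure.pi_of_empty]; simp
  | succ n ih =>
    intro a b ha hb hab A B D hA hB hD h
    rw [pi_slice ρ hA, pi_slice ρ hB, pi_slice ρ hD]
    have e : ∀ φ : ℝ → ℝ≥0∞, Measurable φ → ∫⁻ s, φ s ∂ρ = ∫⁻ s, r s * φ s := by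
      intro φ hφ
      rw [hρ, lintegral_withDensity_eq_lintegral_mul _ hr hφ]; rfl
    rw [e _ (slice_meas ρ hA), e _ (slice_meas ρ hB), e _ (slice_meas ρ hD)]
    refine pl (hr.mul (slice_meas ρ hA)) (hr.mul (slice_meas ρ hB)) (hr.mul (slice_meas ρ hD))
      ha hb hab ?_
    intro s t
    simp only [Pi.mul_apply]
    rw [ENNReal.mul_rpow_of_nonneg _ _ ha.le, ENNReal.mul_rpow_of_nonneg _ _ hb.le,
      mul_mul_mul_comm]
    gcongr
    · exact hlc a b ha hb hab s t
    · refine ih a b ha hb hab _ _ _ (slice_open hA s) (slice_open hB t) (slice_open hD _) ?_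
      intro x hx y hy
      have := h _ hx _ hy
      have e : a • (Fin.cons s x : Fin (n+1) → ℝ) + b • (Fin.cons t y : Fin (n+1) → ℝ) =
        Fin.cons (a * s + b * t) (a • x + b • y) := by
        ext i
        refine Fin.cases ?_ (fun j => ?_) i <;> simp
      rwa [e] at this

theorem lc_volume (n : ℕ) : LC (volume : Measure (Fin n → ℝ)) :=
  lc_pi volume (fun _ => 1) measurable_const (by simp) (by simp) n

theorem half_sym {A D : Set ℝ} (hA : IsOpen A) 
    (h : ∀ s ∈ A, ∀ t ∈ A, (s - t) / 2 ∈ D) : volume A ≤ volume D := by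
  rcases A.eq_empty_or_nonempty with rfl | ⟨x, hx⟩
  · simp
  have h1 : volume ((fun x : ℝ => 2 * x) ⁻¹' A) = ENNReal.ofReal (1/2) * volume A := by
    rw [Real.volume_preimage_mul_left (by norm_num)]
    norm_num [abs_of_pos]
  have h2 : volume ((fun x : ℝ => (-2) * x) ⁻¹' A) = ENNReal.ofReal (1/2) * volume A := by
    rw [Real.volume_preimage_mul_left (by norm_num)]
    congr 2; rw [abs_inv, abs_neg]; norm_num
  have := bm1 (A := (fun x : ℝ => 2 * x) ⁻¹' A) (B := (fun x : ℝ => (-2) * x) ⁻¹' A) (D := D)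
    (hA.preimage (by fun_prop)).measurableSet (hA.preimage (by fun_prop)).measurableSet
    ⟨x / 2, by simpa [mul_div_cancel₀] using hx⟩ ⟨-x / 2, by
      simp only [Set.mem_preimage]; convert hx using 1; ring⟩
    (by
      intro a ha b hb
      have := h _ ha _ hb
      convert this using 1; ring)
  rw [h1, h2, ← add_mul, ← ENNReal.ofReal_add (by norm_num) (by norm_num)] at this
  norm_num at this
  exact this

theorem cons_add_smul {n : ℕ} (s t a b : ℝ) (x y : Fin n → ℝ) :
    a • (Fin.cons s x : Fin (n+1) → ℝ) + b • (Fin.cons t y : Fin (n+1) → ℝ) =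
        Fin.cons (a * s + b * t) (a • x + b • y) := by
  ext i
  refine Fin.cases ?_ (fun j => ?_) i <;> simp

theorem cons_neg {n : ℕ} (s : ℝ) (x : Fin n → ℝ) :
    -(Fin.cons s x : Fin (n+1) → ℝ) = Fin.cons (-s) (-x) := by
  ext i
  refine Fin.cases ?_ (fun j => ?_) i <;> simp

theorem cons_dot {n : ℕ} (s t : ℝ) (x y : Fin n → ℝ) :
    ∑ i, (Fin.cons s x : Fin (n+1) → ℝ) i * (Fin.cons t y : Fin (n+1) → ℝ) i =
      s * t + ∑ i, x i * y i := by
  rw [Fin.sum_univ_succ]; simp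

theorem santalo (n : ℕ) : ∀ (c : ℝ) (K L : Set (Fin n → ℝ)), IsOpen K → IsOpen L →
    (∀ x ∈ K, -x ∈ K) → (∀ x ∈ L, -x ∈ L) → (∀ x ∈ K, ∀ y ∈ L, ∑ i, x i * y i ≤ c) →
    volume K * volume L ≤ ENNReal.ofReal ((2 * π) ^ n * Real.exp c) := by
  induction n with
  | zero =>
    intro c K L _ _ _ _ h
    rcases K.eq_empty_or_nonempty with rfl | ⟨x, hx⟩
    · simp
    rcases L.eq_empty_or_nonempty with rfl | ⟨y, hy⟩
    · simp
    have hc := h x hx y hy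
    simp at hc
    have e : ∀ S : Set (Fin 0 → ℝ), volume S ≤ 1 := by
      intro S
      refine (measure_mono (Set.subset_univ _)).trans ?_
      rw [volume_pi, Measure.pi_of_empty]; simp
    calc _ ≤ (1:ℝ≥0∞) * 1 := by gcongr <;> exact e _
      _ ≤ _ := by simpa using hc
  | succ n ih =>
    intro c K L hK hL hKs hLs h
    let K' : Set (Fin (n+1) → ℝ) := {z | ∃ u : ℝ, (Fin.cons (z 0 + u) (Fin.tail z) : Fin (n+1) → ℝ) ∈ K ∧
      (Fin.cons (-z 0 + u) (Fin.tail z) : Fin (n+1) → ℝ) ∈ K}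
    let L' : Set (Fin (n+1) → ℝ) := {z | ∃ v : Fin n → ℝ,
      (Fin.cons (z 0) (Fin.tail z + v) : Fin (n+1) → ℝ) ∈ L ∧
      (Fin.cons (-z 0) (Fin.tail z - v) : Fin (n+1) → ℝ) ∈ L}
    have memK : ∀ s x, (Fin.cons s x : Fin (n+1) → ℝ) ∈ K' ↔
        ∃ u : ℝ, (Fin.cons (s + u) x : Fin (n+1) → ℝ) ∈ K ∧
          (Fin.cons (-s + u) x : Fin (n+1) → ℝ) ∈ K := fun s x => by
      simp [K']
    have memL : ∀ s x, (Fin.cons s x : Fin (n+1) → ℝ) ∈ L' ↔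
        ∃ v, (Fin.cons s (x + v) : Fin (n+1) → ℝ) ∈ L ∧
          (Fin.cons (-s) (x - v) : Fin (n+1) → ℝ) ∈ L := fun s x => by
      simp [L']
    have ctail : Continuous (fun z : Fin (n+1) → ℝ => (Fin.tail z : Fin n → ℝ)) := by
      refine continuous_pi fun i => ?_
      exact continuous_apply _
    have c0 : Continuous (fun z : Fin (n+1) → ℝ => z 0) := continuous_apply 0
    have oK : IsOpen K' := by
      have : K' = ⋃ u : ℝ, ({z | (Fin.cons (z 0 + u) (Fin.tail z) : Fin (n+1) → ℝ) ∈ K} ∩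
          {z | (Fin.cons (-z 0 + u) (Fin.tail z) : Fin (n+1) → ℝ) ∈ K}) := by
        ext z; simp [K']
      rw [this]
      refine isOpen_iUnion fun u => IsOpen.inter ?_ ?_
      · exact hK.preimage ((cont_cons n).comp ((c0.add_const u).prodMk ctail))
      · exact hK.preimage ((cont_cons n).comp ((c0.neg.add_const u).prodMk ctail))
    have oL : IsOpen L' := by
      have : L' = ⋃ v : Fin n → ℝ, ({z | (Fin.cons (z 0) (Fin.tail z + v) : Fin (n+1) → ℝ) ∈ L} ∩
          {z | (Fin.cons (-z 0) (Fin.tail z - v) : Fin (n+1) → ℝ) ∈ L}) := by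
        ext z; simp [L']
      rw [this]
      refine isOpen_iUnion fun v => IsOpen.inter ?_ ?_
      · exact hL.preimage ((cont_cons n).comp (c0.prodMk (ctail.add_const v)))
      · exact hL.preimage ((cont_cons n).comp (c0.neg.prodMk (ctail.sub continuous_const)))
    have vK : volume K ≤ volume K' := by
      rw [volume_pi, pi_slice' volume hK, pi_slice' volume oK]
      refine lintegral_mono fun x => half_sym (slice_open' hK x) ?_
      intro s hs t ht
      refine (memK _ _).2 ⟨(s + t) / 2, ?_, ?_⟩
      · rw [show (s - t) / 2 + (s + t) / 2 = s by ring]; exact hs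
      · rw [show -((s - t) / 2) + (s + t) / 2 = t by ring]; exact ht
    have vL : volume L ≤ volume L' := by
      rw [volume_pi, pi_slice volume hL, pi_slice volume oL]
      refine lintegral_mono fun t => ?_
      have hneg : ∀ t, {x | (Fin.cons (-t) x : Fin (n+1) → ℝ) ∈ L} =
          -{x | (Fin.cons t x : Fin (n+1) → ℝ) ∈ L} := by
        intro t
        ext x
        simp only [Set.mem_ofPred_eq, Set.mem_neg]
        constructor
        · intro hx
          simpa [cons_neg] using hLs _ hx
        · intro hx
          simpa [cons_neg] using hLs _ hx
      have := lc_volume n (1/2) (1/2) (by norm_num) (by norm_num) (by norm_num)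
        _ _ _ (slice_open hL t) (slice_open hL (-t)) (slice_open oL t) (by
          intro x hx y hy
          refine (memL _ _).2 ⟨(1/2:ℝ) • x - (1/2:ℝ) • y, ?_, ?_⟩
          · rw [show (1/2:ℝ) • x + (1/2:ℝ) • y + ((1/2:ℝ) • x - (1/2:ℝ) • y) = x by module]
            exact hx
          · rw [show (1/2:ℝ) • x + (1/2:ℝ) • y - ((1/2:ℝ) • x - (1/2:ℝ) • y) = y by module]
            exact hy)
      rw [hneg, Measure.measure_neg, ← ENNReal.rpow_add_of_nonneg _ _ (by norm_num) (by norm_num)]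
        at this
      norm_num at this
      exact this
    refine (mul_le_mul' vK vL).trans ?_
    have e1 : volume K' = _ := pi_slice volume oK
    have e2 : volume L' = _ := pi_slice volume oL
    rw [e1, e2]
    refine (san1 (C := ENNReal.ofReal ((2 * π) ^ n * Real.exp c)) (slice_meas volume oK)
      (slice_meas volume oL) ?_ ?_ ?_).trans ?_
    · intro s
      congr 1
      ext x
      simp only [Set.mem_ofPred_eq, memK, neg_neg]
      exact exists_congr fun u => and_comm
    · intro s
      congr 1
      ext x
      simp only [Set.mem_ofPred_eq, memL, neg_neg]
      constructor
      · rintro ⟨v, h1, h2⟩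
        exact ⟨-v, by simpa [← sub_eq_add_neg] using h2, by simpa using h1⟩
      · rintro ⟨v, h1, h2⟩
        exact ⟨-v, by simpa [← sub_eq_add_neg] using h2, by simpa using h1⟩
    · intro s t
      rw [← ENNReal.ofReal_mul (by positivity), mul_assoc, ← Real.exp_add]
      refine ih _ _ _ (slice_open oK s) (slice_open oL t) ?_ ?_ ?_
      · intro x hx
        obtain ⟨u, h1, h2⟩ := (memK _ _).1 hx
        refine (memK _ _).2 ⟨-u, ?_, ?_⟩
        · have := hKs _ h2
          rw [cons_neg] at this
          convert this using 2; ring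
        · have := hKs _ h1
          rw [cons_neg] at this
          convert this using 2; ring
      · intro x hx
        obtain ⟨v, h1, h2⟩ := (memL _ _).1 hx
        refine (memL _ _).2 ⟨v, ?_, ?_⟩
        · have := hLs _ h2
          rw [cons_neg] at this
          convert this using 2 <;> ring
        · have := hLs _ h1
          rw [cons_neg] at this
          convert this using 2; ring
      · intro x hx y hy
        obtain ⟨u, h1, h2⟩ := (memK _ _).1 hx
        obtain ⟨v, h3, h4⟩ := (memL _ _).1 hy
        have k1 := h _ h1 _ h3
        have k2 := h _ h2 _ h4
        rw [cons_dot] at k1 k2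
        simp only [Pi.add_apply, Pi.sub_apply, mul_add, mul_sub, Finset.sum_add_distrib,
          Finset.sum_sub_distrib] at k1 k2
        linarith
    · rw [← ENNReal.ofReal_mul (by positivity)]
      apply le_of_eq
      congr 1
      ring

theorem pi_le_vol (ρ : Measure ℝ) [SigmaFinite ρ] (c : ℝ≥0∞) (hρ : ρ ≤ c • volume) (n : ℕ) :
    ∀ A : Set (Fin n → ℝ), IsOpen A → Measure.pi (fun _ : Fin n => ρ) A ≤ c ^ n * volume A := by
  induction n with
  | zero =>
    intro A _
    rw [volume_pi, Measure.pi_of_empty, Measure.pi_of_empty]; simp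
  | succ n ih =>
    intro A hA
    have e1 : volume A = _ := pi_slice volume hA
    rw [pi_slice ρ hA, e1]
    calc _ ≤ ∫⁻ s, Measure.pi (fun _ : Fin n => ρ) {x | (Fin.cons s x : Fin (n+1) → ℝ) ∈ A}
            ∂(c • volume) := lintegral_mono' hρ le_rfl
      _ ≤ ∫⁻ s, c ^ n * Measure.pi (fun _ : Fin n => volume)
            {x | (Fin.cons s x : Fin (n+1) → ℝ) ∈ A} ∂(c • volume) :=
          lintegral_mono fun s => ih _ (slice_open hA s)
      _ = _ := by
          rw [lintegral_smul_measure, lintegral_const_mul _ (slice_meas volume hA), smul_eq_mul,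
            pow_succ']
          ring

theorem gauss_lc (n : ℕ) : LC (Measure.pi (fun _ : Fin n => ProbabilityTheory.gaussianReal 0 1)) := by
  refine lc_pi _ (ProbabilityTheory.gaussianPDF 0 1) (ProbabilityTheory.measurable_gaussianPDF 0 1)
    (ProbabilityTheory.gaussianReal_of_var_ne_zero 0 one_ne_zero) ?_ n
  intro a b ha hb hab x y
  simp only [ProbabilityTheory.gaussianPDF, ProbabilityTheory.gaussianPDFReal]
  rw [ENNReal.ofReal_rpow_of_nonneg (by positivity) ha.le,
    ENNReal.ofReal_rpow_of_nonneg (by positivity) hb.le, ← ENNReal.ofReal_mul (by positivity)]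
  apply ENNReal.ofReal_le_ofReal
  rw [Real.mul_rpow (by positivity) (by positivity), Real.mul_rpow (by positivity) (by positivity),
    mul_mul_mul_comm, ← Real.rpow_add (by positivity), hab, Real.rpow_one, ← Real.exp_mul,
    ← Real.exp_mul, ← Real.exp_add]
  gcongr
  have : b = 1 - a := by linarith
  subst this
  simp only [sub_zero, NNReal.coe_one, mul_one]
  nlinarith [mul_nonneg (mul_nonneg ha.le hb.le) (sq_nonneg (x - y))]

theorem gauss_vol (n : ℕ) (A : Set (Fin n → ℝ)) (hA : IsOpen A) :
    Measure.pi (fun _ : Fin n => ProbabilityTheory.gaussianReal 0 1) A ≤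
      ENNReal.ofReal ((√(2 * π))⁻¹) ^ n * volume A := by
  refine pi_le_vol _ _ ?_ n A hA
  rw [ProbabilityTheory.gaussianReal_of_var_ne_zero 0 one_ne_zero, ← withDensity_const]
  refine withDensity_mono (Filter.Eventually.of_forall fun x => ?_)
  apply ENNReal.ofReal_le_ofReal
  simp only [ProbabilityTheory.gaussianPDFReal, NNReal.coe_one, mul_one]
  refine mul_le_of_le_one_right (by positivity) ?_
  rw [Real.exp_le_one_iff]
  have := sq_nonneg (x - 0)
  linarith

abbrev EE (n : ℕ) := EuclideanSpace ℝ (Fin n)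
noncomputable abbrev gam (n : ℕ) : Measure (EE n) := ProbabilityTheory.stdGaussian (EE n)

theorem gam_apply {n : ℕ} {A : Set (EE n)} (hA : MeasurableSet A) :
    gam n A = Measure.pi (fun _ : Fin n => ProbabilityTheory.gaussianReal 0 1)
      (WithLp.toLp 2 ⁻¹' A) := by
  rw [gam, ← ProbabilityTheory.map_pi_eq_stdGaussian, Measure.map_apply (by fun_prop) hA]

theorem gam_lc {n : ℕ} {a b : ℝ} (ha : 0 < a) (hb : 0 < b) (hab : a + b = 1) {A B D : Set (EE n)}
    (hA : IsOpen A) (hB : IsOpen B) (hD : IsOpen D) (h : ∀ x ∈ A, ∀ y ∈ B, a • x + b • y ∈ D) :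
    gam n A ^ a * gam n B ^ b ≤ gam n D := by
  rw [gam_apply hA.measurableSet, gam_apply hB.measurableSet, gam_apply hD.measurableSet]
  have ct : Continuous (WithLp.toLp 2 : (Fin n → ℝ) → EE n) := by fun_prop
  exact gauss_lc n a b ha hb hab _ _ _ (hA.preimage ct) (hB.preimage ct) (hD.preimage ct)
    fun x hx y hy => h _ hx _ hy

theorem gam_neg {n : ℕ} {A : Set (EE n)} (hA : MeasurableSet A) :
    gam n ((fun x => -x) ⁻¹' A) = gam n A := by
  have := ProbabilityTheory.stdGaussian_map (LinearIsometryEquiv.neg ℝ (E := EE n))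
  conv_rhs => rw [gam, ← this]
  rw [Measure.map_apply (by fun_prop) hA]
  rfl

theorem gam_rot {n : ℕ} (e : EE n) (he : ‖e‖ = 1) :
    ((gam n).prod (ProbabilityTheory.gaussianReal 0 1)).map
      (fun p : EE n × ℝ => p.1 - inner ℝ e p.1 • e + p.2 • e) = gam n := by
  apply Measure.ext_of_charFun
  ext t
  rw [charFun_apply, integral_map (Measurable.aemeasurable (by fun_prop))
    (Measurable.aestronglyMeasurable (by fun_prop))]
  have e1 : ∀ p : EE n × ℝ, Complex.exp ((inner ℝ (p.1 - inner ℝ e p.1 • e + p.2 • e) t : ℝ) * Complex.I) =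
      Complex.exp ((inner ℝ p.1 (t - inner ℝ e t • e) : ℝ) * Complex.I) *
      Complex.exp ((inner ℝ e t : ℝ) * (p.2 : ℝ) * Complex.I) := by
    intro p
    rw [← Complex.exp_add]
    congr 1
    rw [inner_add_left, inner_sub_left, inner_sub_right, real_inner_smul_left, real_inner_smul_left,
      real_inner_smul_right, real_inner_comm e p.1]
    push_cast
    ring
  simp_rw [e1]
  rw [integral_prod_mul (fun x : EE n => Complex.exp ((inner ℝ x (t - inner ℝ e t • e) : ℝ) * Complex.I))
    (fun s : ℝ => Complex.exp ((inner ℝ e t : ℝ) * (s : ℝ) * Complex.I)), ← charFun_apply,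
    ← charFun_apply_real, ProbabilityTheory.charFun_stdGaussian, ProbabilityTheory.charFun_gaussianReal,
    ProbabilityTheory.charFun_stdGaussian, ← Complex.exp_add]
  congr 1
  have h : ‖t - inner ℝ e t • e‖ ^ 2 = ‖t‖ ^ 2 - (inner ℝ e t) ^ 2 := by
    rw [@norm_sub_sq_real, norm_smul, he, real_inner_smul_right, real_inner_comm e t]
    simp
    ring
  have h' : ((‖t - inner ℝ e t • e‖ : ℝ) : ℂ) ^ 2 = (‖t‖ : ℂ) ^ 2 - ((inner ℝ e t : ℝ) : ℂ) ^ 2 := by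
    exact_mod_cast h
  rw [h']
  simp
  ring

theorem tail_half {t : ℝ} (ht : √2 ≤ t) :
    ProbabilityTheory.gaussianReal 0 1 (Set.Ioi t) ≤ ENNReal.ofReal (Real.exp (-(t^2/2)) / 2) := by
  have ht0 : 0 < t := lt_of_lt_of_le (by positivity) ht
  have hd : ∀ x ∈ Set.Ici t, HasDerivAt (fun s : ℝ => -Real.exp (-(s^2/2))) (x * Real.exp (-(x^2/2))) x := by
    intro x _
    have h1 : HasDerivAt (fun s : ℝ => -(s^2/2)) (-x) x := by
      have := ((hasDerivAt_pow 2 x).div_const 2).neg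
      exact this.congr_deriv (by simp)
    have := h1.exp.neg
    exact this.congr_deriv (by ring)
  have hpos : ∀ x ∈ Set.Ioi t, 0 ≤ x * Real.exp (-(x^2/2)) := fun x hx =>
    mul_nonneg (ht0.le.trans (le_of_lt hx)) (Real.exp_pos _).le
  have hlim : Filter.Tendsto (fun s : ℝ => -Real.exp (-(s^2/2))) Filter.atTop (nhds 0) := by
    rw [← neg_zero]
    refine Filter.Tendsto.neg ?_
    refine Real.tendsto_exp_neg_atTop_nhds_zero.comp ?_
    exact (Filter.tendsto_pow_atTop two_ne_zero).atTop_div_const (by norm_num)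
  have hI := integral_Ioi_of_hasDerivAt_of_nonneg' hd hpos hlim
  have hInt := integrableOn_Ioi_deriv_of_nonneg' hd hpos hlim
  rw [ProbabilityTheory.gaussianReal_apply 0 one_ne_zero]
  calc _ ≤ ∫⁻ x in Set.Ioi t, ENNReal.ofReal (1/2 * (x * Real.exp (-(x^2/2)))) := by
        refine setLIntegral_mono' measurableSet_Ioi fun x hx => ?_
        apply ENNReal.ofReal_le_ofReal
        simp only [ProbabilityTheory.gaussianPDFReal, NNReal.coe_one, mul_one, sub_zero]
        have e : -x^2/2 = -(x^2/2) := by ring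
        rw [e, ← mul_assoc]
        refine mul_le_mul_of_nonneg_right ?_ (Real.exp_pos _).le
        have h2 : √2 ≤ x := ht.trans (le_of_lt hx)
        have hs : 2 ≤ √(2*π) * √2 := by
          rw [← Real.sqrt_mul (by positivity)]
          apply Real.le_sqrt_of_sq_le
          nlinarith [Real.pi_gt_three]
        rw [inv_le_iff_one_le_mul₀ (by positivity)]
        nlinarith [Real.sqrt_nonneg (2*π)]
    _ = ENNReal.ofReal (∫ x in Set.Ioi t, 1/2 * (x * Real.exp (-(x^2/2)))) := by
        rw [ofReal_integral_eq_lintegral_ofReal (hInt.const_mul _)]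
        exact (ae_restrict_mem measurableSet_Ioi).mono fun x hx =>
          mul_nonneg (by norm_num) (hpos x hx)
    _ = _ := by
        rw [integral_const_mul, hI]
        congr 1; ring

theorem tail {t : ℝ} (ht : √2 ≤ t) :
    ENNReal.ofReal (Real.exp (-2 * Real.exp (-(t^2/2)))) ≤
      ProbabilityTheory.gaussianReal 0 1 (Set.Ioo (-t) t) := by
  set γ := ProbabilityTheory.gaussianReal 0 1 with hγ
  have : NullSingletonClass γ := ProbabilityTheory.nullSingletonClass_gaussianReal one_ne_zero
  have h1 := tail_half ht
  have hneg : γ (Set.Iio (-t)) = γ (Set.Ioi t) := by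
    have := ProbabilityTheory.gaussianReal_map_neg (μ := 0) (v := 1)
    rw [neg_zero] at this
    rw [hγ]
    conv_lhs => rw [← this]
    rw [Measure.map_apply (by fun_prop) measurableSet_Iio]
    congr 1
    ext x; simp
  set x := Real.exp (-(t^2/2)) with hx
  have hc : γ (Set.Ioo (-t) t)ᶜ ≤ ENNReal.ofReal x := by
    have hsub : (Set.Ioo (-t) t)ᶜ ⊆ Set.Iic (-t) ∪ Set.Ici t := by
      intro y hy
      simp only [Set.mem_compl_iff, Set.mem_Ioo, not_and_or, not_lt] at hy
      exact hy
    calc _ ≤ γ (Set.Iic (-t)) + γ (Set.Ici t) := (measure_mono hsub).trans (measure_union_le _ _)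
      _ = γ (Set.Ioi t) + γ (Set.Ioi t) := by
        rw [measure_congr (Iio_ae_eq_Iic (μ := γ)).symm, measure_congr (Ioi_ae_eq_Ici (μ := γ)).symm, hneg]
      _ ≤ ENNReal.ofReal (x/2) + ENNReal.ofReal (x/2) := by gcongr
      _ = _ := by rw [← ENNReal.ofReal_add (by positivity) (by positivity)]; congr 1; ring
  have hx0 : 0 < x := Real.exp_pos _
  have ht2 : 2 ≤ t^2 := by
    have := pow_le_pow_left₀ (Real.sqrt_nonneg 2) ht 2
    rwa [Real.sq_sqrt (by norm_num)] at this
  have hx2 : x ≤ 1/2 := by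
    have h3 : x ≤ Real.exp (-1) := Real.exp_le_exp.2 (by linarith)
    have h4 : Real.exp (-1) * Real.exp 1 = 1 := by rw [← Real.exp_add]; simp
    have h5 := Real.add_one_le_exp 1
    nlinarith [Real.exp_pos (-1)]
  have h6 : Real.exp (-2 * x) ≤ 1 - x := by
    have h4 : Real.exp (-2*x) * Real.exp (2*x) = 1 := by rw [← Real.exp_add]; simp
    have h5 := Real.add_one_le_exp (2*x)
    have h7 := Real.exp_pos (-2*x)
    have h8 : Real.exp (-2*x) * (2*x+1) ≤ 1 := 
      (mul_le_mul_of_nonneg_left h5 h7.le).trans_eq h4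
    have h9 : 1 ≤ (1-x)*(2*x+1) := by nlinarith
    nlinarith
  have hadd := measure_add_measure_compl (μ := γ) (measurableSet_Ioo (a := -t) (b := t))
  rw [measure_univ] at hadd
  have : (1:ℝ≥0∞) - ENNReal.ofReal x ≤ γ (Set.Ioo (-t) t) := by
    rw [tsub_le_iff_right, ← hadd]
    gcongr
  refine le_trans ?_ this
  rw [← ENNReal.ofReal_one, ← ENNReal.ofReal_sub _ hx0.le]
  exact ENNReal.ofReal_le_ofReal h6

theorem sidak {n : ℕ} (A : Set (EE n)) (hA : IsOpen A) (hAc : Convex ℝ A) (hAs : ∀ x ∈ A, -x ∈ A)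
    (e : EE n) (he : ‖e‖ = 1) (t : ℝ) (ht : 0 < t) :
    gam n A * ProbabilityTheory.gaussianReal 0 1 (Set.Ioo (-t) t) ≤
      gam n (A ∩ {x | |inner ℝ e x| < t}) := by
  set γ := ProbabilityTheory.gaussianReal 0 1 with hγ
  let T : EE n × ℝ → EE n := fun p => p.1 - inner ℝ e p.1 • e + p.2 • e
  have hT : Continuous T := by fun_prop
  let φ : ℝ → ℝ≥0∞ := fun s => gam n {x | T (x, s) ∈ A}
  have hee : inner ℝ e e = 1 := by simp [he]
  have hinner : ∀ p, inner ℝ e (T p) = p.2 := by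
    intro p
    simp only [T, inner_add_right, inner_sub_right, real_inner_smul_right, hee]
    ring
  have slice : ∀ B : Set (EE n), IsOpen B → gam n B = ∫⁻ s, gam n {x | T (x, s) ∈ B} ∂γ := by
    intro B hB
    conv_lhs => rw [← gam_rot e he]
    rw [Measure.map_apply hT.measurable hB.measurableSet,
      Measure.prod_apply_symm (hB.preimage hT).measurableSet]
    rfl
  have oS : ∀ s, IsOpen {x | T (x, s) ∈ A} := fun s =>
    hA.preimage (hT.comp (Continuous.prodMk_left s))
  have hφm : Measurable φ := measurable_measure_prodMk_right (hA.preimage hT).measurableSet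
  have hφe : ∀ s, φ (-s) = φ s := by
    intro s
    have : {x | T (x, -s) ∈ A} = (fun x => -x) ⁻¹' {x | T (x, s) ∈ A} := by
      ext x
      have hn : T (-x, s) = - T (x, -s) := by
        simp only [T, inner_neg_right]; module
      simp only [Set.mem_ofPred_eq, Set.mem_preimage, hn]
      exact ⟨fun h => hAs _ h, fun h => by simpa using hAs _ h⟩
    simp only [φ]
    rw [this, gam_neg (oS s).measurableSet]
  have hφd : ∀ s u, 0 < u → |s| < u → φ u ≤ φ s := by
    intro s u hu hs
    rw [abs_lt] at hs
    have hab : (u + s) / (2*u) + (u - s) / (2*u) = 1 := by field_simp; ring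
    have ha : 0 < (u + s) / (2*u) := div_pos (by linarith) (by linarith)
    have hb : 0 < (u - s) / (2*u) := div_pos (by linarith) (by linarith)
    have := gam_lc ha hb hab (oS u) (oS (-u)) (oS s) (by
      intro x hx y hy
      have h := hAc hx hy ha.le hb.le hab
      have hs' : s = (u + s) / (2*u) * u + (u - s) / (2*u) * (-u) := by field_simp; ring
      have hl : T ((((u + s) / (2*u)) • x + ((u - s) / (2*u)) • y), s) =
          ((u + s) / (2*u)) • T (x, u) + ((u - s) / (2*u)) • T (y, -u) := by
        generalize (u + s) / (2*u) = a at hs'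
        generalize (u - s) / (2*u) = b at hs'
        subst hs'
        simp only [T, inner_add_right, real_inner_smul_right]
        module
      simp only [Set.mem_ofPred_eq]
      rw [hl]
      exact h)
    have h2 : φ u ^ ((u + s) / (2*u)) * φ (-u) ^ ((u - s) / (2*u)) ≤ φ s := this
    rwa [hφe, ← ENNReal.rpow_add_of_nonneg _ _ ha.le hb.le, hab, ENNReal.rpow_one] at h2
  have hB : MeasurableSet (Set.Ioo (-t) t) := measurableSet_Ioo
  have hI : gam n (A ∩ {x | |inner ℝ e x| < t}) = ∫⁻ s in Set.Ioo (-t) t, φ s ∂γ := by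
    rw [slice _ (hA.inter (isOpen_lt (by fun_prop) continuous_const)), ← lintegral_indicator hB]
    congr 1
    ext s
    by_cases hs : s ∈ Set.Ioo (-t) t
    · have : |s| < t := abs_lt.2 hs
      simp only [Set.indicator_of_mem hs, φ]
      congr 1
      ext x
      simp [hinner, this]
    · have : ¬ |s| < t := fun h => hs (abs_lt.1 h)
      rw [Set.indicator_of_notMem hs]
      simp [hinner, this]
  have hA' : gam n A = (∫⁻ s in Set.Ioo (-t) t, φ s ∂γ) + ∫⁻ s in (Set.Ioo (-t) t)ᶜ, φ s ∂γ := by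
    rw [slice A hA, ← lintegral_add_compl _ hB]
  rw [hI]
  set I := ∫⁻ s in Set.Ioo (-t) t, φ s ∂γ
  have h1 : φ t * γ (Set.Ioo (-t) t) ≤ I := by
    rw [← setLIntegral_const]
    exact setLIntegral_mono' hB fun s hs => hφd s t ht (abs_lt.2 hs)
  have h2 : ∫⁻ s in (Set.Ioo (-t) t)ᶜ, φ s ∂γ ≤ φ t * γ (Set.Ioo (-t) t)ᶜ := by
    rw [← setLIntegral_const]
    refine setLIntegral_mono' hB.compl fun s hs => ?_
    have hst : t ≤ |s| := not_lt.1 fun h => hs (abs_lt.1 h)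
    have habs : φ |s| = φ s := by
      rcases abs_choice s with h | h <;> rw [h]
      exact hφe s
    rcases hst.eq_or_lt with h | h
    · rw [h, habs]
    · rw [← habs]
      exact hφd t |s| (ht.trans h) (by rwa [abs_of_pos ht])
  have hadd := measure_add_measure_compl (μ := γ) hB
  rw [measure_univ] at hadd
  calc gam n A * γ (Set.Ioo (-t) t) ≤ (I + φ t * γ (Set.Ioo (-t) t)ᶜ) * γ (Set.Ioo (-t) t) := by
        rw [hA']; gcongr
    _ = I * γ (Set.Ioo (-t) t) + (φ t * γ (Set.Ioo (-t) t)) * γ (Set.Ioo (-t) t)ᶜ := by ring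
    _ ≤ I * γ (Set.Ioo (-t) t) + I * γ (Set.Ioo (-t) t)ᶜ := by gcongr
    _ = I := by rw [← mul_add, hadd, mul_one]

theorem sidak_step {n : ℕ} (A : Set (EE n)) (hA : IsOpen A) (hAc : Convex ℝ A)
    (hAs : ∀ x ∈ A, -x ∈ A) (v : EE n) (α : ℝ) (hα0 : 0 < α) (hα : √2 * ‖v‖ ≤ α) :
    gam n A * ENNReal.ofReal (Real.exp (-2 * Real.exp (-α^2 / (2 * ‖v‖^2)))) ≤
      gam n (A ∩ {x | |inner ℝ v x| < α}) := by
  by_cases hv : v = 0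
  · subst hv
    have : A ∩ {x | |inner ℝ (0 : EE n) x| < α} = A := by
      ext x; simp [hα0]
    rw [this]
    refine mul_le_of_le_one_right' ?_
    rw [ENNReal.ofReal_le_one]
    exact Real.exp_le_one_iff.2 (by have := Real.exp_pos (-α^2 / (2 * ‖(0 : EE n)‖^2)); linarith)
  · have hv' : 0 < ‖v‖ := norm_pos_iff.2 hv
    have he : ‖(‖v‖⁻¹ • v)‖ = 1 := by
      rw [norm_smul, norm_inv, norm_norm, inv_mul_cancel₀ hv'.ne']
    have ht : √2 ≤ α / ‖v‖ := (le_div_iff₀ hv').2 hα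
    have h1 := sidak A hA hAc hAs (‖v‖⁻¹ • v) he (α / ‖v‖) (by positivity)
    have h2 := tail ht
    have h3 : -((α / ‖v‖)^2/2) = -α^2 / (2 * ‖v‖^2) := by field_simp
    rw [h3] at h2
    have h4 : {x : EE n | |inner ℝ (‖v‖⁻¹ • v) x| < α / ‖v‖} = {x | |inner ℝ v x| < α} := by
      ext x
      simp only [Set.mem_ofPred_eq, real_inner_smul_left, abs_mul, abs_inv, abs_norm]
      rw [inv_mul_eq_div, div_lt_div_iff_of_pos_right hv']
    rw [h4] at h1
    exact le_trans (by gcongr) h1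

theorem sidak_all {n N : ℕ} (v : Fin N → EE n) (α : ℝ) (hα0 : 0 < α)
    (hα : ∀ i, √2 * ‖v i‖ ≤ α) (S : Finset (Fin N)) :
    IsOpen {x : EE n | ∀ i ∈ S, |inner ℝ (v i) x| < α} ∧
    Convex ℝ {x : EE n | ∀ i ∈ S, |inner ℝ (v i) x| < α} ∧
    ENNReal.ofReal (Real.exp (-2 * ∑ i ∈ S, Real.exp (-α^2 / (2 * ‖v i‖^2)))) ≤
      gam n {x : EE n | ∀ i ∈ S, |inner ℝ (v i) x| < α} := by
  classical
  induction S using Finset.induction_on with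
  | empty => simp [convex_univ]
  | insert i S hi ih =>
    obtain ⟨h1, h2, h3⟩ := ih
    have hset : {x : EE n | ∀ j ∈ insert i S, |inner ℝ (v j) x| < α} =
        {x : EE n | ∀ j ∈ S, |inner ℝ (v j) x| < α} ∩ {x | |inner ℝ (v i) x| < α} := by
      ext x; simp [and_comm]
    rw [hset]
    refine ⟨h1.inter (isOpen_lt (by fun_prop) continuous_const), h2.inter ?_, ?_⟩
    · have : {x : EE n | |inner ℝ (v i) x| < α} = (innerₛₗ ℝ (v i)) ⁻¹' (Set.Ioo (-α) α) := by
        ext x; simp [abs_lt]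
      rw [this]
      exact (convex_Ioo _ _).linear_preimage _
    · refine le_trans ?_ (sidak_step _ h1 h2 ?_ (v i) α hα0 (hα i))
      · rw [Finset.sum_insert hi, mul_add, Real.exp_add, mul_comm, ENNReal.ofReal_mul (Real.exp_pos _).le]
        gcongr
      · intro x hx j hj
        simpa using hx j hj

theorem absconv_volume_bound (n N : ℕ) (hn : 0 < n) (hN : 0 < N)
    (w : Fin N → (Fin n → ℝ)) (α : ℝ)
    (hα : ∀ i, Real.sqrt 2 * Real.sqrt (∑ j, (w i j) ^ 2) ≤ α) (hα0 : 0 < α) :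
    (volume (convexHull ℝ (Set.range w ∪ -Set.range w))) ^ ((1 : ℝ) / n) ≤
      ENNReal.ofReal
        (Real.sqrt (2 * Real.pi) * Real.exp 1 * α / n *
          Real.exp ((2 / n) *
            ∑ i : Fin N, Real.exp (-α ^ 2 / (2 * ∑ j, (w i j) ^ 2)))) := by
  have hn' : (0:ℝ) < n := Nat.cast_pos.2 hn
  set Sg := ∑ i : Fin N, Real.exp (-α ^ 2 / (2 * ∑ j, (w i j) ^ 2)) with hSg
  set C := convexHull ℝ (Set.range w ∪ -Set.range w) with hC
  let U : Set (Fin n → ℝ) := {x | ∀ i, |∑ j, x j * w i j| < α}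
  let K : Set (Fin n → ℝ) := {x | ∀ i, |∑ j, x j * w i j| < n}
  have hop : ∀ r : ℝ, IsOpen {x : Fin n → ℝ | ∀ i, |∑ j, x j * w i j| < r} := by
    intro r
    simp only [Set.ofPred_forall]
    exact isOpen_iInter_of_finite fun i => isOpen_lt (by fun_prop) continuous_const
  have hU : IsOpen U := hop α
  have hK : IsOpen K := hop n
  have hnorm : ∀ i, ‖(WithLp.toLp 2 (w i) : EE n)‖ ^ 2 = ∑ j, (w i j)^2 := by
    intro i; rw [EuclideanSpace.real_norm_sq_eq]
  have hG : ENNReal.ofReal (Real.exp (-2 * Sg)) ≤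
      ENNReal.ofReal ((√(2 * π))⁻¹) ^ n * volume U := by
    have h := sidak_all (fun i => (WithLp.toLp 2 (w i) : EE n)) α hα0 (by
      intro i
      refine le_trans (le_of_eq ?_) (hα i)
      congr 1
      rw [← hnorm, Real.sqrt_sq (norm_nonneg _)]) Finset.univ
    obtain ⟨h1, -, h3⟩ := h
    rw [gam_apply h1.measurableSet] at h3
    refine le_trans (le_of_eq ?_) (h3.trans (le_trans (le_of_eq ?_) (gauss_vol n U hU)))
    · simp only [hnorm]; rfl
    · congr 1
      ext x
      simp [U, PiLp.inner_apply]
  have hKU : volume K = ENNReal.ofReal ((n/α)^n) * volume U := by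
    have : K = (n/α : ℝ) • U := by
      ext x
      rw [Set.mem_smul_set_iff_inv_smul_mem₀ (by positivity)]
      simp only [K, U, Set.mem_ofPred_eq]
      refine forall_congr' fun i => ?_
      have : ∑ j, ((n/α : ℝ)⁻¹ • x) j * w i j = (n/α : ℝ)⁻¹ * ∑ j, x j * w i j := by
        rw [Finset.mul_sum]; simp [mul_assoc]
      rw [this, abs_mul, abs_of_pos (show (0:ℝ) < (n/α : ℝ)⁻¹ by positivity),
        inv_mul_lt_iff₀ (by positivity), div_mul_cancel₀ _ hα0.ne']
    rw [this, Measure.addHaar_smul, abs_of_nonneg (by positivity)]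
    simp
  have hCc : Convex ℝ C := convex_convexHull ℝ _
  have hCs : -C = C := by
    rw [hC, ← convexHull_neg, Set.union_neg, neg_neg, Set.union_comm]
  have hCi : volume C = volume (interior C) := by
    refine le_antisymm ?_ (measure_mono interior_subset)
    have h0 := hCc.addHaar_frontier volume
    calc volume C ≤ volume (interior C ∪ frontier C) := by
          refine measure_mono ?_
          rw [← closure_eq_interior_union_frontier]; exact subset_closure
      _ ≤ _ := (measure_union_le _ _).trans (by rw [h0, add_zero])
  have hS := santalo n n K (interior C) hK isOpen_interior
    (by intro x hx i
        simpa using hx i)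
    (by intro x hx
        have : -interior C = interior C := by
          conv_rhs => rw [← hCs]
          exact ((Homeomorph.neg (Fin n → ℝ)).preimage_interior C)
        rw [← this]; simpa using hx)
    (by intro x hx y hy
        have hy' := interior_subset hy
        let l : (Fin n → ℝ) →ₗ[ℝ] ℝ := ∑ i, x i • LinearMap.proj i
        have hl : ∀ z, l z = ∑ i, x i * z i := by intro z; simp [l]
        have : C ⊆ l ⁻¹' Set.Iic (n:ℝ) := by
          refine convexHull_min ?_ ((convex_Iic _).linear_preimage l)
          rintro z (⟨i, rfl⟩ | ⟨i, hi⟩)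
          · have := (abs_lt.1 (hx i)).2
            simp only [Set.mem_preimage, Set.mem_Iic, hl]; exact this.le
          · have h1 := (abs_lt.1 (hx i)).1
            have h2 : l z = - l (w i) := by rw [hi, map_neg, neg_neg]
            simp only [Set.mem_preimage, Set.mem_Iic, h2, hl]; linarith
        have h3 := this hy'
        simp only [Set.mem_preimage, Set.mem_Iic, hl] at h3
        exact h3)
  rw [← hCi, hKU] at hS
  set V := √(2*π) with hV
  have hV0 : 0 < V := by positivity
  have hV2 : V^2 = 2*π := Real.sq_sqrt (by positivity)
  set B := V * Real.exp 1 * α / n with hB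
  have hB0 : 0 < B := by positivity
  have key : volume C ≤ ENNReal.ofReal (B^n * Real.exp (2 * Sg)) := by
    have hk : ENNReal.ofReal (Real.exp (-2 * Sg)) * ENNReal.ofReal ((n/α)^n) * volume C ≤
        ENNReal.ofReal (V⁻¹) ^ n * ENNReal.ofReal ((2 * π) ^ n * Real.exp n) := by
      calc _ ≤ (ENNReal.ofReal (V⁻¹) ^ n * volume U) * ENNReal.ofReal ((n/α)^n) * volume C := by gcongr
        _ = ENNReal.ofReal (V⁻¹) ^ n * (ENNReal.ofReal ((n/α)^n) * volume U * volume C) := by ring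
        _ ≤ _ := by gcongr
    rw [← ENNReal.ofReal_mul (by positivity), ← ENNReal.ofReal_pow (by positivity),
      ← ENNReal.ofReal_mul (by positivity)] at hk
    set d := Real.exp (-2 * Sg) * (n/α)^n with hd
    have hd0 : 0 < d := by positivity
    have : volume C ≤ ENNReal.ofReal (V⁻¹ ^ n * ((2 * π) ^ n * Real.exp n)) / ENNReal.ofReal d := by
      rw [ENNReal.le_div_iff_mul_le (Or.inl (by simpa using hd0)) (Or.inl ENNReal.ofReal_ne_top)]
      rwa [mul_comm]
    refine this.trans (le_of_eq ?_)
    rw [← ENNReal.ofReal_div_of_pos hd0]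
    congr 1
    rw [div_eq_iff hd0.ne', hd, hB, ← hV2]
    have e1 : Real.exp (2 * Sg) * Real.exp (-2 * Sg) = 1 := by rw [← Real.exp_add]; simp
    have e2 : Real.exp (n:ℝ) = Real.exp 1 ^ n := by rw [← Real.exp_nat_mul, mul_one]
    calc V⁻¹ ^ n * ((V^2)^n * Real.exp n) = (V * Real.exp 1)^n := by
          rw [e2, ← mul_pow, ← mul_pow]; congr 1; field_simp
      _ = (V * Real.exp 1 * α / n)^n * (n/α)^n := by
          rw [← mul_pow]; congr 1; field_simp
      _ = (V * Real.exp 1 * α / n)^n * (n/α)^n * (Real.exp (2 * Sg) * Real.exp (-2 * Sg)) := by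
          rw [e1, mul_one]
      _ = _ := by ring
  refine (ENNReal.rpow_le_rpow key (by positivity)).trans (le_of_eq ?_)
  rw [ENNReal.ofReal_rpow_of_nonneg (by positivity) (by positivity),
    Real.mul_rpow (by positivity) (by positivity), ← Real.exp_mul, one_div,
    Real.pow_rpow_inv_natCast hB0.le hn.ne']
  congr 3
  field_simp
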